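/- Let D be a positive natural number, d < D a natural number, ε > 0 a real number, and let N_d, N_{d'}, N_{d+1} be positive real numbers. If (D − d)/D + √(ε · log(N_d) / N_{d'}) ≤ (D − (d+1))/D + √(ε · log(N_d) / N_{d+1}), then N_d ≥ exp(N_{d+1} / (ε · D²)). -/

import Mathlib

/-- D-chain UCB comparison: if the D-UCT score of the terminating suboptimal child
is at most that of the progressing child, then the parent visit count `N_d`
must be at least `exp(N_{d+1} / (ε D²))`. -/
theorem dchain_exp_visit_bound
    (D : ℕ) (hD : 0 < D) (d : ℕ) (hd : d < D)
    (ε : ℝ) (hε : 0 < ε)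
    (Nd Nd' Nd1 : ℝ) (hNd : 0 < Nd) (hNd' : 0 < Nd') (hNd1 : 0 < Nd1)
    (h : ((D : ℝ) - d) / D + Real.sqrt (ε * Real.log Nd / Nd')
        ≤ ((D : ℝ) - (d + 1)) / D + Real.sqrt (ε * Real.log Nd / Nd1)) :
    Nd ≥ Real.exp (Nd1 / (ε * (D : ℝ) ^ 2)) := by
  have hD' : (0 : ℝ) < D := by exact_mod_cast hD
  have hgap : ((D : ℝ) - d) / D - ((D : ℝ) - (d + 1)) / D = 1 / D := by ring
  have hsqrt : 1 / (D : ℝ) ≤ Real.sqrt (ε * Real.log Nd / Nd1) := by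
    linarith [Real.sqrt_nonneg (ε * Real.log Nd / Nd')]
  have hsq : (1 / (D : ℝ)) ^ 2 ≤ ε * Real.log Nd / Nd1 :=
    (Real.le_sqrt' (by positivity)).mp hsqrt
  rw [ge_iff_le, ← Real.le_log_iff_exp_le hNd, div_le_iff₀ (by positivity)]
  rw [div_pow, one_pow, div_le_div_iff₀ (by positivity) hNd1] at hsq
  linarith
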